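/- (Theorem 2) Assume the setup of the nonlocal contact problem for an elliptic equation with variable coefficients, with constants βᵢ⁻ > 0 (i = 1,…,n) and βⱼ⁺ > 0 (j = 1,…,m) satisfying 0 < Σ_{i=1}^{n} βᵢ⁻ + Σ_{j=1}^{m} βⱼ⁺ ≤ 1. Then the problem has at most one regular solution: if u and v are both regular solutions with the same data (f⁻, f⁺, φ⁻, φ⁺, φ⁰), then u = v on the closure of D. -/

import Mathlib

open Set

/-- Partial derivative in the first variable. -/
noncomputable def pd1 (u : ℝ × ℝ → ℝ) (p : ℝ × ℝ) : ℝ := deriv (fun s => u (s, p.2)) p.1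

/-- Partial derivative in the second variable. -/
noncomputable def pd2 (u : ℝ × ℝ → ℝ) (p : ℝ × ℝ) : ℝ := deriv (fun s => u (p.1, s)) p.2

/-- The elliptic operator `L u = Σ_{α,β} ∂_{x_α}(K_{αβ} ∂_{x_β} u) − k·u`. -/
noncomputable def Lop (K11 K12 K21 K22 k u : ℝ × ℝ → ℝ) (p : ℝ × ℝ) : ℝ :=
  pd1 (fun q => K11 q * pd1 u q + K12 q * pd2 u q) p
    + pd2 (fun q => K21 q * pd1 u q + K22 q * pd2 u q) p
    - k p * u p

/-- A regular solution of the nonlocal contact problem for an elliptic equation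
with variable coefficients on `D = (0,a)×(0,b)`, with contact line `x₁ = ξ⁰`,
interior lines `x₁ = ξᵢ⁻` (in `D⁻`) and `x₁ = ξⱼ⁺` (in `D⁺`), and
data `(f⁻, f⁺, φ⁻, φ⁺, φ⁰)`. -/
def RegSol (a b ξ0 : ℝ) {n m : ℕ} (ξm : Fin n → ℝ) (ξp : Fin m → ℝ)
    (βm : Fin n → ℝ) (βp : Fin m → ℝ)
    (Km11 Km12 Km21 Km22 km Kp11 Kp12 Kp21 Kp22 kp : ℝ × ℝ → ℝ)
    (fm fp φm φp : ℝ × ℝ → ℝ) (φ0 : ℝ → ℝ) (u : ℝ × ℝ → ℝ) : Prop :=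
  ContinuousOn u (Icc 0 a ×ˢ Icc 0 b) ∧
  ContDiffOn ℝ 2 u (Ioo 0 ξ0 ×ˢ Ioo 0 b) ∧
  ContDiffOn ℝ 2 u (Ioo ξ0 a ×ˢ Ioo 0 b) ∧
  (∀ p ∈ Ioo 0 ξ0 ×ˢ Ioo (0:ℝ) b, Lop Km11 Km12 Km21 Km22 km u p = -fm p) ∧
  (∀ p ∈ Ioo ξ0 a ×ˢ Ioo (0:ℝ) b, Lop Kp11 Kp12 Kp21 Kp22 kp u p = -fp p) ∧
  (∀ p ∈ (Icc 0 ξ0 ×ˢ ({0} : Set ℝ)) ∪ (Icc 0 ξ0 ×ˢ ({b} : Set ℝ)) ∪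
      (({0} : Set ℝ) ×ˢ Icc 0 b), u p = φm p) ∧
  (∀ p ∈ (Icc ξ0 a ×ˢ ({0} : Set ℝ)) ∪ (Icc ξ0 a ×ˢ ({b} : Set ℝ)) ∪
      (({a} : Set ℝ) ×ˢ Icc 0 b), u p = φp p) ∧
  (∀ x₂ ∈ Icc (0:ℝ) b, u (ξ0, x₂) =
    (∑ i, βm i * u (ξm i, x₂)) + (∑ j, βp j * u (ξp j, x₂)) + φ0 x₂)

open Filter Topology

section PartialDerivatives

variable {u v : ℝ × ℝ → ℝ} {p : ℝ × ℝ}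

lemma DifferentiableAt.hasDerivAt_comp_line (p d : ℝ × ℝ) (t : ℝ)
    (hu : DifferentiableAt ℝ u (p.1 + t * d.1, p.2 + t * d.2)) :
    HasDerivAt (fun s : ℝ => u (p.1 + s * d.1, p.2 + s * d.2))
      (fderiv ℝ u (p.1 + t * d.1, p.2 + t * d.2) d) t := by
  have h1 : HasDerivAt (fun s : ℝ => (p.1 + s * d.1, p.2 + s * d.2)) (d.1, d.2) t := by
    have e1 : HasDerivAt (fun s : ℝ => p.1 + s * d.1) d.1 t := by
      simpa using ((hasDerivAt_id t).mul_const d.1).const_add p.1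
    have e2 : HasDerivAt (fun s : ℝ => p.2 + s * d.2) d.2 t := by
      simpa using ((hasDerivAt_id t).mul_const d.2).const_add p.2
    exact e1.prodMk e2
  exact hu.hasFDerivAt.comp_hasDerivAt t h1

lemma DifferentiableAt.pd1_eq (hu : DifferentiableAt ℝ u p) : pd1 u p = fderiv ℝ u p (1, 0) := by
  have h : HasDerivAt (fun s : ℝ => (s, p.2)) ((1 : ℝ), (0 : ℝ)) p.1 :=
    (hasDerivAt_id p.1).prodMk (hasDerivAt_const _ _)
  exact (HasFDerivAt.comp_hasDerivAt p.1 (f := fun s : ℝ => (s, p.2)) hu.hasFDerivAt h).deriv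

lemma DifferentiableAt.pd2_eq (hu : DifferentiableAt ℝ u p) : pd2 u p = fderiv ℝ u p (0, 1) := by
  have h : HasDerivAt (fun s : ℝ => (p.1, s)) ((0 : ℝ), (1 : ℝ)) p.2 :=
    (hasDerivAt_const _ _).prodMk (hasDerivAt_id p.2)
  exact (HasFDerivAt.comp_hasDerivAt p.2 (f := fun s : ℝ => (p.1, s)) hu.hasFDerivAt h).deriv

lemma DifferentiableAt.fderiv_apply_eq_pd (hu : DifferentiableAt ℝ u p) (d : ℝ × ℝ) :
    fderiv ℝ u p d = d.1 * pd1 u p + d.2 * pd2 u p := by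
  have hd : d = d.1 • ((1 : ℝ), (0 : ℝ)) + d.2 • ((0 : ℝ), (1 : ℝ)) := by ext <;> simp
  rw [hu.pd1_eq, hu.pd2_eq]
  conv_lhs => rw [hd]
  simp only [map_add, map_smul, smul_eq_mul]

lemma ContDiffAt.eventually_differentiableAt (hu : ContDiffAt ℝ 2 u p) :
    ∀ᶠ q in 𝓝 p, DifferentiableAt ℝ u q :=
  (hu.eventually (by simp)).mono fun _ hq => hq.differentiableAt (by simp)

lemma ContDiffAt.pd1_eventuallyEq (hu : ContDiffAt ℝ 2 u p) :
    pd1 u =ᶠ[𝓝 p] fun q => fderiv ℝ u q (1, 0) :=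
  hu.eventually_differentiableAt.mono fun _ hq => hq.pd1_eq

lemma ContDiffAt.pd2_eventuallyEq (hu : ContDiffAt ℝ 2 u p) :
    pd2 u =ᶠ[𝓝 p] fun q => fderiv ℝ u q (0, 1) :=
  hu.eventually_differentiableAt.mono fun _ hq => hq.pd2_eq

lemma ContDiffAt.differentiableAt_fderiv_two (hu : ContDiffAt ℝ 2 u p) :
    DifferentiableAt ℝ (fderiv ℝ u) p :=
  (hu.fderiv_right (m := 1) (by norm_num)).differentiableAt (by simp)

lemma ContDiffAt.differentiableAt_pd1 (hu : ContDiffAt ℝ 2 u p) :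
    DifferentiableAt ℝ (pd1 u) p :=
  (hu.differentiableAt_fderiv_two.clm_apply (differentiableAt_const _)).congr_of_eventuallyEq
    hu.pd1_eventuallyEq

lemma ContDiffAt.differentiableAt_pd2 (hu : ContDiffAt ℝ 2 u p) :
    DifferentiableAt ℝ (pd2 u) p :=
  (hu.differentiableAt_fderiv_two.clm_apply (differentiableAt_const _)).congr_of_eventuallyEq
    hu.pd2_eventuallyEq

lemma ContDiffAt.pd2_pd1_eq (hu : ContDiffAt ℝ 2 u p) : pd2 (pd1 u) p = pd1 (pd2 u) p := by
  have hs : IsSymmSndFDerivAt ℝ u p := hu.isSymmSndFDerivAt (by simp)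
  rw [hu.differentiableAt_pd1.pd2_eq, hu.differentiableAt_pd2.pd1_eq,
    hu.pd1_eventuallyEq.fderiv_eq, hu.pd2_eventuallyEq.fderiv_eq,
    fderiv_clm_apply hu.differentiableAt_fderiv_two (differentiableAt_const _),
    fderiv_clm_apply hu.differentiableAt_fderiv_two (differentiableAt_const _)]
  simpa using hs (0, 1) (1, 0)

lemma pd1_add (hu : DifferentiableAt ℝ u p) (hv : DifferentiableAt ℝ v p) :
    pd1 (fun q => u q + v q) p = pd1 u p + pd1 v p := by
  rw [(hu.fun_add hv).pd1_eq, hu.pd1_eq, hv.pd1_eq,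
    fderiv_fun_add hu hv]; simp

lemma pd2_add (hu : DifferentiableAt ℝ u p) (hv : DifferentiableAt ℝ v p) :
    pd2 (fun q => u q + v q) p = pd2 u p + pd2 v p := by
  rw [(hu.fun_add hv).pd2_eq, hu.pd2_eq, hv.pd2_eq,
    fderiv_fun_add hu hv]; simp

lemma pd1_mul (hu : DifferentiableAt ℝ u p) (hv : DifferentiableAt ℝ v p) :
    pd1 (fun q => u q * v q) p = pd1 u p * v p + u p * pd1 v p := by
  rw [(hu.fun_mul hv).pd1_eq, hu.pd1_eq, hv.pd1_eq,
    fderiv_fun_mul hu hv]; simp; ring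

lemma pd2_mul (hu : DifferentiableAt ℝ u p) (hv : DifferentiableAt ℝ v p) :
    pd2 (fun q => u q * v q) p = pd2 u p * v p + u p * pd2 v p := by
  rw [(hu.fun_mul hv).pd2_eq, hu.pd2_eq, hv.pd2_eq,
    fderiv_fun_mul hu hv]; simp; ring

lemma pd1_congr (h : u =ᶠ[𝓝 p] v) : pd1 u p = pd1 v p :=
  Filter.EventuallyEq.deriv_eq
    ((show ContinuousAt (fun s : ℝ => (s, p.2)) p.1 by fun_prop).eventually h)

lemma pd2_congr (h : u =ᶠ[𝓝 p] v) : pd2 u p = pd2 v p :=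
  Filter.EventuallyEq.deriv_eq
    ((show ContinuousAt (fun s : ℝ => (p.1, s)) p.2 by fun_prop).eventually h)

lemma pd1_add_const_mul (c : ℝ) (hu : DifferentiableAt ℝ u p) (hv : DifferentiableAt ℝ v p) :
    pd1 (fun q => u q + c * v q) p = pd1 u p + c * pd1 v p := by
  rw [pd1_add hu (hv.const_mul c), pd1_mul (differentiableAt_const c) hv]
  simp [pd1]

lemma pd2_add_const_mul (c : ℝ) (hu : DifferentiableAt ℝ u p) (hv : DifferentiableAt ℝ v p) :
    pd2 (fun q => u q + c * v q) p = pd2 u p + c * pd2 v p := by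
  rw [pd2_add hu (hv.const_mul c), pd2_mul (differentiableAt_const c) hv]
  simp [pd2]

lemma ContDiffAt.pd1_add_const_mul_eventuallyEq (c : ℝ) (hu : ContDiffAt ℝ 2 u p)
    (hv : ContDiffAt ℝ 2 v p) :
    pd1 (fun q => u q + c * v q) =ᶠ[𝓝 p] fun q => pd1 u q + c * pd1 v q := by
  filter_upwards [hu.eventually_differentiableAt, hv.eventually_differentiableAt] with q h1 h2
  exact pd1_add_const_mul c h1 h2

lemma ContDiffAt.pd2_add_const_mul_eventuallyEq (c : ℝ) (hu : ContDiffAt ℝ 2 u p)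
    (hv : ContDiffAt ℝ 2 v p) :
    pd2 (fun q => u q + c * v q) =ᶠ[𝓝 p] fun q => pd2 u q + c * pd2 v q := by
  filter_upwards [hu.eventually_differentiableAt, hv.eventually_differentiableAt] with q h1 h2
  exact pd2_add_const_mul c h1 h2

lemma ContDiffOn.continuousOn_pd1 {U : Set (ℝ × ℝ)} (hU : IsOpen U) (hu : ContDiffOn ℝ 1 u U) :
    ContinuousOn (pd1 u) U :=
  ((hu.continuousOn_fderiv_of_isOpen hU le_rfl).clm_apply continuousOn_const).congr
    fun _ hq => ((hu.contDiffAt (hU.mem_nhds hq)).differentiableAt (by simp)).pd1_eq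

lemma ContDiffOn.continuousOn_pd2 {U : Set (ℝ × ℝ)} (hU : IsOpen U) (hu : ContDiffOn ℝ 1 u U) :
    ContinuousOn (pd2 u) U :=
  ((hu.continuousOn_fderiv_of_isOpen hU le_rfl).clm_apply continuousOn_const).congr
    fun _ hq => ((hu.contDiffAt (hU.mem_nhds hq)).differentiableAt (by simp)).pd2_eq

end PartialDerivatives

section LocalMax

lemma IsLocalMax.deriv_deriv_nonpos {f : ℝ → ℝ} {x : ℝ} (h : IsLocalMax f x)
    (hc : ContinuousAt f x) : deriv (deriv f) x ≤ 0 := by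
  by_contra! hpos
  have hmin := isLocalMin_of_deriv_deriv_pos hpos h.deriv_eq_zero hc
  have hconst : f =ᶠ[𝓝 x] fun _ => f x := by
    filter_upwards [h, hmin] with y h1 h2 using le_antisymm h1 h2
  have h2 : deriv f =ᶠ[𝓝 x] fun _ => 0 := by
    simpa using hconst.deriv
  rw [h2.deriv_eq] at hpos
  simp at hpos

variable {u : ℝ × ℝ → ℝ} {p : ℝ × ℝ}

/-- Second order necessary condition for a local maximum. -/
lemma IsLocalMax.hessian_nonpos (h : IsLocalMax u p) (hu : ContDiffAt ℝ 2 u p) (d : ℝ × ℝ) :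
    d.1 ^ 2 * pd1 (pd1 u) p + 2 * d.1 * d.2 * pd1 (pd2 u) p + d.2 ^ 2 * pd2 (pd2 u) p ≤ 0 := by
  set γ : ℝ → ℝ × ℝ := fun s => (p.1 + s * d.1, p.2 + s * d.2) with hγ
  have hγ0 : γ 0 = p := by simp [hγ]
  have hγc : Tendsto γ (𝓝 0) (𝓝 p) := by
    have : ContinuousAt γ 0 := by fun_prop
    simpa [ContinuousAt, hγ0] using this
  have hmax : IsLocalMax (u ∘ γ) 0 := by
    have := hγc.eventually h
    simpa [IsLocalMax, IsMaxFilter, hγ0] using this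
  have hder : deriv (u ∘ γ) =ᶠ[𝓝 0] fun t => d.1 * pd1 u (γ t) + d.2 * pd2 u (γ t) := by
    filter_upwards [hγc.eventually hu.eventually_differentiableAt] with t ht
    rw [← ht.fderiv_apply_eq_pd d]
    exact (DifferentiableAt.hasDerivAt_comp_line p d t ht).deriv
  have hcont : ContinuousAt (u ∘ γ) 0 :=
    ContinuousAt.comp (by simpa [hγ0] using hu.continuousAt) (by fun_prop)
  have key := hmax.deriv_deriv_nonpos hcont
  rw [hder.deriv_eq] at key
  have h1 := DifferentiableAt.hasDerivAt_comp_line (u := pd1 u) p d 0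
    (by simpa using hu.differentiableAt_pd1)
  have h2 := DifferentiableAt.hasDerivAt_comp_line (u := pd2 u) p d 0
    (by simpa using hu.differentiableAt_pd2)
  have h3 := ((h1.const_mul d.1).add (h2.const_mul d.2)).deriv
  simp only [zero_mul, add_zero, Prod.mk.eta, hu.differentiableAt_pd1.fderiv_apply_eq_pd,
    hu.differentiableAt_pd2.fderiv_apply_eq_pd, hu.pd2_pd1_eq] at h3
  have h4 : deriv (fun t => d.1 * pd1 u (γ t) + d.2 * pd2 u (γ t)) 0 =
      d.1 * (d.1 * pd1 (pd1 u) p + d.2 * pd1 (pd2 u) p) +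
        d.2 * (d.1 * pd1 (pd2 u) p + d.2 * pd2 (pd2 u) p) := h3
  rw [h4] at key
  linarith

end LocalMax

section Operator

variable {K11 K12 K21 K22 k u v : ℝ × ℝ → ℝ} {p : ℝ × ℝ}

/-- Nondivergence form of the operator. -/
lemma Lop_eq (h11 : DifferentiableAt ℝ K11 p) (h12 : DifferentiableAt ℝ K12 p)
    (h21 : DifferentiableAt ℝ K21 p) (h22 : DifferentiableAt ℝ K22 p) (hu : ContDiffAt ℝ 2 u p) :
    Lop K11 K12 K21 K22 k u p =
      K11 p * pd1 (pd1 u) p + (K12 p + K21 p) * pd1 (pd2 u) p + K22 p * pd2 (pd2 u) p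
        + (pd1 K11 p + pd2 K21 p) * pd1 u p + (pd1 K12 p + pd2 K22 p) * pd2 u p - k p * u p := by
  have hu1 := hu.differentiableAt_pd1
  have hu2 := hu.differentiableAt_pd2
  unfold Lop
  rw [pd1_add (h11.fun_mul hu1) (h12.fun_mul hu2),
    pd2_add (h21.fun_mul hu1) (h22.fun_mul hu2),
    pd1_mul h11 hu1, pd1_mul h12 hu2, pd2_mul h21 hu1, pd2_mul h22 hu2, hu.pd2_pd1_eq]
  ring

lemma Lop_add_const_mul (c : ℝ) (h11 : DifferentiableAt ℝ K11 p) (h12 : DifferentiableAt ℝ K12 p)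
    (h21 : DifferentiableAt ℝ K21 p) (h22 : DifferentiableAt ℝ K22 p)
    (hu : ContDiffAt ℝ 2 u p) (hv : ContDiffAt ℝ 2 v p) :
    Lop K11 K12 K21 K22 k (fun q => u q + c * v q) p =
      Lop K11 K12 K21 K22 k u p + c * Lop K11 K12 K21 K22 k v p := by
  have huv : ContDiffAt ℝ 2 (fun q => u q + c * v q) p := hu.add (contDiffAt_const.mul hv)
  have e1 := hu.pd1_add_const_mul_eventuallyEq c hv
  have e2 := hu.pd2_add_const_mul_eventuallyEq c hv
  rw [Lop_eq h11 h12 h21 h22 huv, Lop_eq h11 h12 h21 h22 hu, Lop_eq h11 h12 h21 h22 hv,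
    pd1_congr e1, pd1_congr e2, pd2_congr e2, e1.self_of_nhds, e2.self_of_nhds,
    pd1_add_const_mul c hu.differentiableAt_pd1 hv.differentiableAt_pd1,
    pd1_add_const_mul c hu.differentiableAt_pd2 hv.differentiableAt_pd2,
    pd2_add_const_mul c hu.differentiableAt_pd2 hv.differentiableAt_pd2]
  ring

/-- An elliptic operator is nonpositive at a nonnegative local maximum. -/
lemma IsLocalMax.Lop_nonpos (h : IsLocalMax u p) (h11 : DifferentiableAt ℝ K11 p)
    (h12 : DifferentiableAt ℝ K12 p) (h21 : DifferentiableAt ℝ K21 p)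
    (h22 : DifferentiableAt ℝ K22 p) (hu : ContDiffAt ℝ 2 u p) (hpos : 0 < K11 p)
    (hell : (K12 p + K21 p) ^ 2 < 4 * K11 p * K22 p) (hk : 0 ≤ k p) (hup : 0 ≤ u p) :
    Lop K11 K12 K21 K22 k u p ≤ 0 := by
  have hf : fderiv ℝ u p = 0 := h.fderiv_eq_zero
  have hd := hu.differentiableAt (by simp)
  rw [Lop_eq h11 h12 h21 h22 hu, hd.pd1_eq, hd.pd2_eq, hf]
  have H1 := h.hessian_nonpos hu (2 * K11 p, K12 p + K21 p)
  have H2 := h.hessian_nonpos hu (0, 1)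
  simp only at H1 H2
  have hku := mul_nonneg hk hup
  have H3 : 4 * K11 p * (K11 p * pd1 (pd1 u) p + (K12 p + K21 p) * pd1 (pd2 u) p
      + K22 p * pd2 (pd2 u) p) ≤ 0 := by
    have : 0 ≤ (4 * K11 p * K22 p - (K12 p + K21 p) ^ 2) * -pd2 (pd2 u) p :=
      mul_nonneg (by linarith) (by linarith)
    linarith
  have H4 := nonpos_of_mul_nonpos_right H3 (by positivity)
  simp only [zero_apply, mul_zero]
  linarith

end Operator

section Barrier

/-- The squared Euclidean distance on `ℝ × ℝ`. -/
def sqDist (c z : ℝ × ℝ) : ℝ := (z.1 - c.1) ^ 2 + (z.2 - c.2) ^ 2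

lemma contDiff_sqDist (c : ℝ × ℝ) {n : WithTop ℕ∞} : ContDiff ℝ n (sqDist c) := by
  unfold sqDist; fun_prop

lemma sqDist_pos {c z : ℝ × ℝ} (h : z ≠ c) : 0 < sqDist c z := by
  unfold sqDist
  by_contra! hle
  have h1 : z.1 - c.1 = 0 := by nlinarith [sq_nonneg (z.1 - c.1), sq_nonneg (z.2 - c.2)]
  have h2 : z.2 - c.2 = 0 := by nlinarith [sq_nonneg (z.1 - c.1), sq_nonneg (z.2 - c.2)]
  exact h (Prod.ext (by linarith) (by linarith))

/-- The exponential barrier used in the proof of Hopf's maximum principle. -/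
noncomputable def hopfBarrier (α : ℝ) (c q z : ℝ × ℝ) : ℝ :=
  Real.exp (-α * sqDist c z) - Real.exp (-α * sqDist c q)

variable (α : ℝ) (c q : ℝ × ℝ)

lemma contDiff_hopfBarrier {n : WithTop ℕ∞} : ContDiff ℝ n (hopfBarrier α c q) :=
  ((contDiff_const.mul (contDiff_sqDist c)).exp).sub contDiff_const

lemma hasDerivAt_exp_sqDist_fst (x y : ℝ) :
    HasDerivAt (fun s => Real.exp (-α * sqDist c (s, y)))
      (-2 * α * (x - c.1) * Real.exp (-α * sqDist c (x, y))) x := by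
  have h : HasDerivAt (fun s => -α * sqDist c (s, y)) (-α * (2 * (x - c.1))) x := by
    have := ((((hasDerivAt_id x).sub_const c.1).pow 2).add_const ((y - c.2) ^ 2)).const_mul (-α)
    simpa [sqDist] using this
  exact h.exp.congr_deriv (by ring)

lemma hasDerivAt_exp_sqDist_snd (x y : ℝ) :
    HasDerivAt (fun s => Real.exp (-α * sqDist c (x, s)))
      (-2 * α * (y - c.2) * Real.exp (-α * sqDist c (x, y))) y := by
  have h : HasDerivAt (fun s => -α * sqDist c (x, s)) (-α * (2 * (y - c.2))) y := by
    have := ((((hasDerivAt_id y).sub_const c.2).pow 2).const_add ((x - c.1) ^ 2)).const_mul (-α)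
    simpa [sqDist] using this
  exact h.exp.congr_deriv (by ring)

lemma pd1_hopfBarrier : pd1 (hopfBarrier α c q) =
    fun z => -2 * α * (z.1 - c.1) * Real.exp (-α * sqDist c z) := by
  ext z
  exact ((hasDerivAt_exp_sqDist_fst α c z.1 z.2).sub_const _).deriv

lemma pd2_hopfBarrier : pd2 (hopfBarrier α c q) =
    fun z => -2 * α * (z.2 - c.2) * Real.exp (-α * sqDist c z) := by
  ext z
  exact ((hasDerivAt_exp_sqDist_snd α c z.1 z.2).sub_const _).deriv

lemma pd1_pd1_hopfBarrier (z : ℝ × ℝ) : pd1 (pd1 (hopfBarrier α c q)) z =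
    (4 * α ^ 2 * (z.1 - c.1) ^ 2 - 2 * α) * Real.exp (-α * sqDist c z) := by
  rw [pd1_hopfBarrier]
  have := ((((hasDerivAt_id z.1).sub_const c.1).const_mul (-2 * α)).mul
    (hasDerivAt_exp_sqDist_fst α c z.1 z.2)).deriv
  refine this.trans ?_
  simp only [id]; ring

lemma pd1_pd2_hopfBarrier (z : ℝ × ℝ) : pd1 (pd2 (hopfBarrier α c q)) z =
    4 * α ^ 2 * (z.1 - c.1) * (z.2 - c.2) * Real.exp (-α * sqDist c z) := by
  rw [pd2_hopfBarrier]
  have := ((hasDerivAt_exp_sqDist_fst α c z.1 z.2).const_mul (-2 * α * (z.2 - c.2))).deriv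
  refine this.trans ?_
  ring

lemma pd2_pd2_hopfBarrier (z : ℝ × ℝ) : pd2 (pd2 (hopfBarrier α c q)) z =
    (4 * α ^ 2 * (z.2 - c.2) ^ 2 - 2 * α) * Real.exp (-α * sqDist c z) := by
  rw [pd2_hopfBarrier]
  have := ((((hasDerivAt_id z.2).sub_const c.2).const_mul (-2 * α)).mul
    (hasDerivAt_exp_sqDist_snd α c z.1 z.2)).deriv
  refine this.trans ?_
  simp only [id]; ring

variable {α c q} {K11 K12 K21 K22 k : ℝ × ℝ → ℝ}

lemma Lop_hopfBarrier_ge {p : ℝ × ℝ} (h11 : DifferentiableAt ℝ K11 p)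
    (h12 : DifferentiableAt ℝ K12 p) (h21 : DifferentiableAt ℝ K21 p)
    (h22 : DifferentiableAt ℝ K22 p) (hk : 0 ≤ k p) :
    (4 * α ^ 2 * (K11 p * (p.1 - c.1) ^ 2 + (K12 p + K21 p) * ((p.1 - c.1) * (p.2 - c.2))
        + K22 p * (p.2 - c.2) ^ 2)
      - α * (2 * (K11 p + K22 p) + 2 * ((pd1 K11 p + pd2 K21 p) * (p.1 - c.1)
        + (pd1 K12 p + pd2 K22 p) * (p.2 - c.2))) - k p) * Real.exp (-α * sqDist c p)
      ≤ Lop K11 K12 K21 K22 k (hopfBarrier α c q) p := by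
  rw [Lop_eq h11 h12 h21 h22 (contDiff_hopfBarrier α c q).contDiffAt, pd1_pd1_hopfBarrier,
    pd1_pd2_hopfBarrier, pd2_pd2_hopfBarrier, pd1_hopfBarrier, pd2_hopfBarrier, hopfBarrier]
  have := mul_nonneg hk (Real.exp_pos (-α * sqDist c q)).le
  linarith

/-- For a large parameter, the barrier is a strict subsolution away from its centre. -/
lemma exists_Lop_hopfBarrier_pos {N U : Set (ℝ × ℝ)} (hU : IsOpen U) (hN : IsCompact N)
    (hNU : N ⊆ U) (hc : c ∉ N)
    (h11 : ContDiffOn ℝ 1 K11 U) (h12 : ContDiffOn ℝ 1 K12 U) (h21 : ContDiffOn ℝ 1 K21 U)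
    (h22 : ContDiffOn ℝ 1 K22 U) (hkc : ContinuousOn k U)
    (hpos : ∀ p ∈ U, 0 < K11 p) (hell : ∀ p ∈ U, (K12 p + K21 p) ^ 2 < 4 * K11 p * K22 p)
    (hk : ∀ p ∈ U, 0 ≤ k p) (q : ℝ × ℝ) :
    ∃ α > 0, ∀ p ∈ N, 0 < Lop K11 K12 K21 K22 k (hopfBarrier α c q) p := by
  have c11 := h11.continuousOn
  have c12 := h12.continuousOn
  have c21 := h21.continuousOn
  have c22 := h22.continuousOn
  have d11 := h11.continuousOn_pd1 hU
  have d12 := h12.continuousOn_pd1 hU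
  have d21 := h21.continuousOn_pd2 hU
  have d22 := h22.continuousOn_pd2 hU
  obtain ⟨l, hl0, hl⟩ := hN.exists_forall_le' (a := 0)
    (f := fun p => K11 p * (p.1 - c.1) ^ 2 + (K12 p + K21 p) * ((p.1 - c.1) * (p.2 - c.2))
        + K22 p * (p.2 - c.2) ^ 2) (ContinuousOn.mono (by fun_prop) hNU) (by
      intro p hp
      have hpU := hNU hp
      have hne : p ≠ c := fun h => hc (h ▸ hp)
      have hs := sqDist_pos hne
      unfold sqDist at hs
      have hK := hpos p hpU
      have he := hell p hpU
      refine pos_of_mul_pos_right (a := 4 * K11 p) ?_ (by positivity)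
      rcases eq_or_ne (p.2 - c.2) 0 with h0 | h0
      · rw [h0] at hs ⊢
        have : 0 < (p.1 - c.1) ^ 2 := by linarith
        have := mul_pos (mul_pos hK hK) this
        linarith
      · have h2 : 0 < (p.2 - c.2) ^ 2 := by positivity
        have h3 := mul_pos (sub_pos.2 he) h2
        nlinarith [sq_nonneg (2 * K11 p * (p.1 - c.1) + (K12 p + K21 p) * (p.2 - c.2))])
  obtain ⟨C₁, hC₁⟩ := hN.exists_bound_of_continuousOn
    (f := fun p => 2 * (K11 p + K22 p) + 2 * ((pd1 K11 p + pd2 K21 p) * (p.1 - c.1)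
        + (pd1 K12 p + pd2 K22 p) * (p.2 - c.2))) (ContinuousOn.mono (by fun_prop) hNU)
  obtain ⟨C₂, hC₂⟩ := hN.exists_bound_of_continuousOn (hkc.mono hNU)
  set C := max 0 (max C₁ C₂) with hCdef
  have hC0 : 0 ≤ C := le_max_left _ _
  have hC1 : C₁ ≤ C := (le_max_left _ _).trans (le_max_right _ _)
  have hC2 : C₂ ≤ C := (le_max_right _ _).trans (le_max_right _ _)
  set α := max 1 ((2 * C + 1) / (4 * l)) with hα
  have hα1 : 1 ≤ α := le_max_left _ _
  have hα2 : 2 * C + 1 ≤ α * (4 * l) := (div_le_iff₀ (by positivity)).1 (le_max_right _ _)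
  have hα0 : 0 < α := by linarith
  refine ⟨α, hα0, fun p hp => ?_⟩
  have hpU := hNU hp
  have D : ∀ {K : ℝ × ℝ → ℝ}, ContDiffOn ℝ 1 K U → DifferentiableAt ℝ K p := fun h =>
    (h.contDiffAt (hU.mem_nhds hpU)).differentiableAt (by simp)
  refine lt_of_lt_of_le (mul_pos ?_ (Real.exp_pos _))
    (Lop_hopfBarrier_ge (D h11) (D h12) (D h21) (D h22) (hk p hpU))
  have e1 := mul_le_mul_of_nonneg_left (hl p hp) (by positivity : 0 ≤ 4 * α ^ 2)
  have e2 := mul_le_mul_of_nonneg_left (((le_abs_self _).trans (hC₁ p hp)).trans hC1) hα0.le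
  have e3 := ((le_abs_self _).trans (hC₂ p hp)).trans hC2
  nlinarith [mul_nonneg (sub_nonneg.2 hα1) (sub_nonneg.2 hα2), mul_nonneg (sub_nonneg.2 hα1) hC0,
    mul_nonneg hα0.le (sub_nonneg.2 hα2)]

end Barrier

section StrongMaximumPrinciple

variable {K11 K12 K21 K22 k w : ℝ × ℝ → ℝ} {U : Set (ℝ × ℝ)} {M : ℝ}

/-- A subsolution cannot touch its nonnegative upper bound at exactly one point of a closed disc
when that point lies on the bounding circle and in the interior of the domain. -/
lemma not_touching_disc (hU : IsOpen U)
    (h11 : ContDiffOn ℝ 1 K11 U) (h12 : ContDiffOn ℝ 1 K12 U) (h21 : ContDiffOn ℝ 1 K21 U)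
    (h22 : ContDiffOn ℝ 1 K22 U) (hkc : ContinuousOn k U)
    (hpos : ∀ p ∈ U, 0 < K11 p) (hell : ∀ p ∈ U, (K12 p + K21 p) ^ 2 < 4 * K11 p * K22 p)
    (hk : ∀ p ∈ U, 0 ≤ k p) (hw : ContDiffOn ℝ 2 w U)
    (hL : ∀ p ∈ U, 0 ≤ Lop K11 K12 K21 K22 k w p) (hM : 0 ≤ M) (hwM : ∀ p ∈ U, w p ≤ M)
    {c q : ℝ × ℝ} (hq : q ∈ U) (hqc : q ≠ c) (hwq : w q = M)
    (htouch : ∀ z ∈ U, z ≠ q → sqDist c z ≤ sqDist c q → w z < M) : False := by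
  obtain ⟨δ₀, hδ₀, hδU⟩ := Metric.nhds_basis_closedBall.mem_iff.1 (hU.mem_nhds hq)
  set δ := min δ₀ (dist c q / 2) with hδdef
  have hcq : 0 < dist c q := dist_pos.2 hqc.symm
  have hδ : 0 < δ := lt_min hδ₀ (by positivity)
  have hNU : Metric.closedBall q δ ⊆ U :=
    (Metric.closedBall_subset_closedBall (min_le_left _ _)).trans hδU
  have hcN : c ∉ Metric.closedBall q δ := fun h => by
    have h1 : dist c q ≤ δ := h
    have h2 : δ ≤ dist c q / 2 := min_le_right _ _
    linarith
  have hN : IsCompact (Metric.closedBall q δ) := isCompact_closedBall _ _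
  obtain ⟨α, hα, hLpos⟩ := exists_Lop_hopfBarrier_pos hU hN hNU hcN h11 h12 h21 h22 hkc hpos hell
    hk q
  set h := hopfBarrier α c q with hh
  have hhc : ContDiff ℝ 2 h := contDiff_hopfBarrier α c q
  have hgc : Continuous (sqDist c) := (contDiff_sqDist c (n := 0)).continuous
  obtain ⟨η, hη, hηle⟩ := ((isCompact_sphere q δ).inter_right
      (isClosed_le hgc (continuous_const (y := sqDist c q)))).exists_forall_le' (a := 0)
    (f := fun z => M - w z)
    (continuousOn_const.sub (hw.continuousOn.mono
      (inter_subset_left.trans (Metric.sphere_subset_closedBall.trans hNU))))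
    (fun z hz => sub_pos.2 <| htouch z (hNU (Metric.sphere_subset_closedBall hz.1))
      (fun e => by
        have h0 : dist z q = δ := hz.1
        rw [e, dist_self] at h0
        exact hδ.ne h0) hz.2)
  set ε := η / 2 with hεdef
  have hε : 0 < ε := by positivity
  have hsphere : ∀ z ∈ Metric.sphere q δ, w z + ε * h z < M := by
    intro z hz
    rcases le_or_gt (sqDist c z) (sqDist c q) with hle | hgt
    · have h1 : h z ≤ 1 := by
        have e1 : Real.exp (-α * sqDist c z) ≤ 1 := by
          rw [Real.exp_le_one_iff]
          have : 0 ≤ α * sqDist c z := mul_nonneg hα.le (by unfold sqDist; positivity)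
          linarith
        have e2 := Real.exp_pos (-α * sqDist c q)
        simp only [hh, hopfBarrier]
        linarith
      have h2 : η ≤ M - w z := hηle z ⟨hz, hle⟩
      have h3 := mul_le_mul_of_nonneg_left h1 hε.le
      linarith
    · have h1 : h z < 0 := by
        simp only [hh, hopfBarrier, sub_neg, Real.exp_lt_exp]
        have := mul_lt_mul_of_pos_left hgt hα
        linarith
      have h2 := hwM z (hNU (Metric.sphere_subset_closedBall hz))
      have h3 := mul_neg_of_pos_of_neg hε h1
      linarith
  have hhq : h q = 0 := by simp [hh, hopfBarrier]
  obtain ⟨p, hpN, hpmax⟩ := hN.exists_isMaxOn ⟨q, Metric.mem_closedBall_self hδ.le⟩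
    (f := fun z => w z + ε * h z)
    ((hw.continuousOn.mono hNU).add (continuous_const.mul hhc.continuous).continuousOn)
  have hpM : M ≤ w p + ε * h p := by
    have : w q + ε * h q ≤ w p + ε * h p := hpmax (Metric.mem_closedBall_self hδ.le)
    rwa [hhq, mul_zero, add_zero, hwq] at this
  have hpball : p ∈ Metric.ball q δ := by
    refine lt_of_le_of_ne (Metric.mem_closedBall.1 hpN) fun e => ?_
    exact absurd (hsphere p e) (not_lt.2 hpM)
  have hlm : IsLocalMax (fun z => w z + ε * h z) p :=
    hpmax.isLocalMax (mem_of_superset (Metric.isOpen_ball.mem_nhds hpball)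
      Metric.ball_subset_closedBall)
  have hpU := hNU hpN
  have D : ∀ {K : ℝ × ℝ → ℝ}, ContDiffOn ℝ 1 K U → DifferentiableAt ℝ K p := fun h =>
    (h.contDiffAt (hU.mem_nhds hpU)).differentiableAt (by simp)
  have hwp := hw.contDiffAt (hU.mem_nhds hpU)
  have key := hlm.Lop_nonpos (k := k) (D h11) (D h12) (D h21) (D h22)
    (hwp.add (contDiffAt_const.mul hhc.contDiffAt)) (hpos p hpU) (hell p hpU) (hk p hpU)
    (hM.trans hpM)
  rw [Lop_add_const_mul ε (D h11) (D h12) (D h21) (D h22) hwp hhc.contDiffAt] at key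
  have := mul_pos hε (hLpos p hpN)
  have := hL p hpU
  linarith

lemma isOpen_setOf_eq_max (hU : IsOpen U)
    (h11 : ContDiffOn ℝ 1 K11 U) (h12 : ContDiffOn ℝ 1 K12 U) (h21 : ContDiffOn ℝ 1 K21 U)
    (h22 : ContDiffOn ℝ 1 K22 U) (hkc : ContinuousOn k U)
    (hpos : ∀ p ∈ U, 0 < K11 p) (hell : ∀ p ∈ U, (K12 p + K21 p) ^ 2 < 4 * K11 p * K22 p)
    (hk : ∀ p ∈ U, 0 ≤ k p) (hw : ContDiffOn ℝ 2 w U)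
    (hL : ∀ p ∈ U, 0 ≤ Lop K11 K12 K21 K22 k w p) (hM : 0 ≤ M) (hwM : ∀ p ∈ U, w p ≤ M) :
    IsOpen {p ∈ U | w p = M} := by
  rw [Metric.isOpen_iff]
  rintro p ⟨hpU, hwp⟩
  obtain ⟨ρ, hρ, hρU⟩ := Metric.nhds_basis_closedBall.mem_iff.1 (hU.mem_nhds hpU)
  refine ⟨ρ / 4, by positivity, fun c hc => ?_⟩
  have hcU : c ∈ U := hρU (Metric.ball_subset_closedBall (Metric.ball_subset_ball (by linarith) hc))
  refine ⟨hcU, ?_⟩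
  by_contra hwc
  rw [Metric.mem_ball, Prod.dist_eq, max_lt_iff, Real.dist_eq, Real.dist_eq] at hc
  have hc1 := abs_lt.1 hc.1
  have hc2 := abs_lt.1 hc.2
  have hT : IsCompact (Metric.closedBall p ρ ∩ w ⁻¹' {M}) :=
    (isCompact_closedBall p ρ).of_isClosed_subset
      ((hw.continuousOn.mono hρU).preimage_isClosed_of_isClosed Metric.isClosed_closedBall
        isClosed_singleton) inter_subset_left
  have hpT : p ∈ Metric.closedBall p ρ ∩ w ⁻¹' {M} := ⟨Metric.mem_closedBall_self hρ.le, hwp⟩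
  obtain ⟨q, ⟨hqρ, hqM⟩, hqmin⟩ := hT.exists_isMinOn ⟨p, hpT⟩
    (contDiff_sqDist c (n := 0)).continuous.continuousOn
  have hqM' : w q = M := hqM
  have hqp : sqDist c q ≤ sqDist c p := hqmin hpT
  have hpc : sqDist c p ≤ 2 * (ρ / 4) ^ 2 := by
    have e1 : (p.1 - c.1) ^ 2 ≤ (ρ / 4) ^ 2 := sq_le_sq' (by linarith) (by linarith)
    have e2 : (p.2 - c.2) ^ 2 ≤ (ρ / 4) ^ 2 := sq_le_sq' (by linarith) (by linarith)
    unfold sqDist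
    linarith
  have hqc : q ≠ c := fun e => hwc (e ▸ hqM')
  refine not_touching_disc hU h11 h12 h21 h22 hkc hpos hell hk hw hL hM hwM (hρU hqρ)
    (c := ((c.1 + q.1) / 2, (c.2 + q.2) / 2)) (fun e => hqc ?_) hqM' ?_
  · have e1 := congrArg Prod.fst e
    have e2 := congrArg Prod.snd e
    simp only at e1 e2
    exact Prod.ext (by linarith) (by linarith)
  · intro z hzU hzq hz
    refine lt_of_le_of_ne (hwM z hzU) fun hzM => ?_
    have hlt : sqDist c z < sqDist c q := by
      have := sqDist_pos hzq
      simp only [sqDist] at this hz ⊢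
      nlinarith
    have hzρ : z ∈ Metric.closedBall p ρ := by
      have h1 : sqDist c z ≤ (ρ / 2) ^ 2 := by nlinarith [sq_nonneg ρ]
      unfold sqDist at h1
      have e1 := abs_le.1 (abs_le_of_sq_le_sq (a := z.1 - c.1) (b := ρ / 2)
        (by linarith [sq_nonneg (z.2 - c.2)]) (by positivity))
      have e2 := abs_le.1 (abs_le_of_sq_le_sq (a := z.2 - c.2) (b := ρ / 2)
        (by linarith [sq_nonneg (z.1 - c.1)]) (by positivity))
      rw [Metric.mem_closedBall, Prod.dist_eq, max_le_iff, Real.dist_eq, Real.dist_eq, abs_le,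
        abs_le]
      exact ⟨⟨by linarith, by linarith⟩, by linarith, by linarith⟩
    have : sqDist c q ≤ sqDist c z := hqmin ⟨hzρ, hzM⟩
    linarith

/-- Strong maximum principle for subsolutions of the elliptic operator. -/
theorem eqOn_of_isPreconnected_of_exists_eq_max (hU : IsOpen U) (hUc : IsPreconnected U)
    (hK : ∀ K ∈ [K11, K12, K21, K22, k], ContDiffOn ℝ 1 K U)
    (hpos : ∀ p ∈ U, 0 < K11 p) (hell : ∀ p ∈ U, (K12 p + K21 p) ^ 2 < 4 * K11 p * K22 p)
    (hk : ∀ p ∈ U, 0 ≤ k p) (hw : ContDiffOn ℝ 2 w U)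
    (hL : ∀ p ∈ U, 0 ≤ Lop K11 K12 K21 K22 k w p) (hM : 0 ≤ M) (hwM : ∀ p ∈ U, w p ≤ M)
    {q : ℝ × ℝ} (hq : q ∈ U) (hwq : w q = M) : EqOn w (fun _ => M) U := by
  have hopen := isOpen_setOf_eq_max hU (hK _ (by simp)) (hK _ (by simp)) (hK _ (by simp))
    (hK _ (by simp)) (hK k (by simp)).continuousOn hpos hell hk hw hL hM hwM
  have hsub := hUc.subset_of_closure_inter_subset hopen ⟨q, hq, hq, hwq⟩ (by
    rintro z ⟨hz, hzU⟩
    refine ⟨hzU, ?_⟩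
    obtain ⟨x, hx, hxz⟩ := mem_closure_iff_seq_limit.1 hz
    have h1 := ((hw.continuousOn.continuousAt (hU.mem_nhds hzU)).tendsto.comp hxz)
    refine tendsto_nhds_unique h1 ?_
    simp only [Function.comp_def, (hx _).2, tendsto_const_nhds])
  exact fun z hz => (hsub hz).2

/-- A subsolution on a rectangle, continuous up to the boundary, with a boundary value strictly
below its nonnegative upper bound, never attains this bound in the interior. -/
lemma lt_max_of_rectangle {x₀ x₁ y₀ y₁ : ℝ}
    (hK : ∀ K ∈ [K11, K12, K21, K22, k], ContDiffOn ℝ 1 K (Ioo x₀ x₁ ×ˢ Ioo y₀ y₁))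
    (hpos : ∀ p ∈ Ioo x₀ x₁ ×ˢ Ioo y₀ y₁, 0 < K11 p)
    (hell : ∀ p ∈ Ioo x₀ x₁ ×ˢ Ioo y₀ y₁, (K12 p + K21 p) ^ 2 < 4 * K11 p * K22 p)
    (hk : ∀ p ∈ Ioo x₀ x₁ ×ˢ Ioo y₀ y₁, 0 ≤ k p)
    (hwc : ContinuousOn w (Icc x₀ x₁ ×ˢ Icc y₀ y₁))
    (hw : ContDiffOn ℝ 2 w (Ioo x₀ x₁ ×ˢ Ioo y₀ y₁))
    (hL : ∀ p ∈ Ioo x₀ x₁ ×ˢ Ioo y₀ y₁, 0 ≤ Lop K11 K12 K21 K22 k w p) (hM : 0 ≤ M)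
    (hwM : ∀ p ∈ Ioo x₀ x₁ ×ˢ Ioo y₀ y₁, w p ≤ M)
    {r : ℝ × ℝ} (hr : r ∈ Icc x₀ x₁ ×ˢ Icc y₀ y₁) (hwr : w r < M)
    {q : ℝ × ℝ} (hq : q ∈ Ioo x₀ x₁ ×ˢ Ioo y₀ y₁) : w q < M := by
  refine lt_of_le_of_ne (hwM q hq) fun hwq => hwr.ne ?_
  have h1 := eqOn_of_isPreconnected_of_exists_eq_max (isOpen_Ioo.prod isOpen_Ioo)
    (isPreconnected_Ioo.prod isPreconnected_Ioo) hK hpos hell hk hw hL hM hwM hq hwq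
  have hx : x₀ ≠ x₁ := (hq.1.1.trans hq.1.2).ne
  have hy : y₀ ≠ y₁ := (hq.2.1.trans hq.2.2).ne
  refine h1.of_subset_closure hwc continuousOn_const
    (prod_mono Ioo_subset_Icc_self Ioo_subset_Icc_self) ?_ hr
  rw [closure_prod_eq, closure_Ioo hx, closure_Ioo hy]

end StrongMaximumPrinciple

section Uniqueness

variable {a b ξ0 : ℝ} {n m : ℕ} {ξm : Fin n → ℝ} {ξp : Fin m → ℝ} {βm : Fin n → ℝ}
  {βp : Fin m → ℝ} {Km11 Km12 Km21 Km22 km Kp11 Kp12 Kp21 Kp22 kp : ℝ × ℝ → ℝ}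

lemma Lop_sub_eq_zero {K11 K12 K21 K22 k f u v : ℝ × ℝ → ℝ} {U : Set (ℝ × ℝ)} (hU : IsOpen U)
    (hK : ∀ K ∈ [K11, K12, K21, K22, k], ContDiffOn ℝ 1 K U)
    (hu : ContDiffOn ℝ 2 u U) (hv : ContDiffOn ℝ 2 v U)
    (hLu : ∀ p ∈ U, Lop K11 K12 K21 K22 k u p = -f p)
    (hLv : ∀ p ∈ U, Lop K11 K12 K21 K22 k v p = -f p) {p : ℝ × ℝ} (hp : p ∈ U) :
    Lop K11 K12 K21 K22 k (fun q => u q + -1 * v q) p = 0 := by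
  have D : ∀ K ∈ [K11, K12, K21, K22, k], DifferentiableAt ℝ K p := fun K h =>
    ((hK K h).contDiffAt (hU.mem_nhds hp)).differentiableAt (by simp)
  rw [Lop_add_const_mul (-1) (D _ (by simp)) (D _ (by simp)) (D _ (by simp)) (D _ (by simp))
    (hu.contDiffAt (hU.mem_nhds hp)) (hv.contDiffAt (hU.mem_nhds hp)), hLu p hp, hLv p hp]
  ring

/-- The difference of two regular solutions solves the homogeneous problem. -/
lemma RegSol.sub {fm fp φm φp : ℝ × ℝ → ℝ} {φ0 : ℝ → ℝ} {u v : ℝ × ℝ → ℝ}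
    (hKmreg : ∀ K ∈ [Km11, Km12, Km21, Km22, km],
      ContDiffOn ℝ 1 K (Ioo 0 ξ0 ×ˢ Ioo (0:ℝ) b))
    (hKpreg : ∀ K ∈ [Kp11, Kp12, Kp21, Kp22, kp],
      ContDiffOn ℝ 1 K (Ioo ξ0 a ×ˢ Ioo (0:ℝ) b))
    (hu : RegSol a b ξ0 ξm ξp βm βp Km11 Km12 Km21 Km22 km Kp11 Kp12 Kp21 Kp22 kp
        fm fp φm φp φ0 u)
    (hv : RegSol a b ξ0 ξm ξp βm βp Km11 Km12 Km21 Km22 km Kp11 Kp12 Kp21 Kp22 kp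
        fm fp φm φp φ0 v) :
    RegSol a b ξ0 ξm ξp βm βp Km11 Km12 Km21 Km22 km Kp11 Kp12 Kp21 Kp22 kp
        0 0 0 0 0 (fun q => u q + -1 * v q) := by
  obtain ⟨u1, u2, u3, u4, u5, u6, u7, u8⟩ := hu
  obtain ⟨v1, v2, v3, v4, v5, v6, v7, v8⟩ := hv
  refine ⟨u1.add (continuousOn_const.mul v1), u2.add (contDiffOn_const.mul v2),
    u3.add (contDiffOn_const.mul v3), fun p hp => ?_, fun p hp => ?_, fun p hp => ?_,
    fun p hp => ?_, fun y hy => ?_⟩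
  · simpa using Lop_sub_eq_zero (isOpen_Ioo.prod isOpen_Ioo) hKmreg u2 v2 u4 v4 hp
  · simpa using Lop_sub_eq_zero (isOpen_Ioo.prod isOpen_Ioo) hKpreg u3 v3 u5 v5 hp
  · simp [u6 p hp, v6 p hp]
  · simp [u7 p hp, v7 p hp]
  · simp only [u8 y hy, v8 y hy, mul_add, Finset.sum_add_distrib, Pi.zero_apply]
    simp only [mul_left_comm _ (-1 : ℝ), ← Finset.mul_sum]
    ring

/-- A solution of the homogeneous nonlocal contact problem is nonpositive. -/
lemma RegSol.nonpos {w : ℝ × ℝ → ℝ} (hb : 0 < b)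
    (hξ0 : 0 < ξ0) (hξ0a : ξ0 < a)
    (hξm : ∀ i, 0 < ξm i ∧ ξm i < ξ0) (hξp : ∀ j, ξ0 < ξp j ∧ ξp j < a)
    (hβm : ∀ i, 0 < βm i) (hβp : ∀ j, 0 < βp j)
    (hβpos : 0 < (∑ i, βm i) + (∑ j, βp j))
    (hβ1 : (∑ i, βm i) + (∑ j, βp j) ≤ 1)
    (hKmreg : ∀ K ∈ [Km11, Km12, Km21, Km22, km],
      ContDiffOn ℝ 1 K (Ioo 0 ξ0 ×ˢ Ioo (0:ℝ) b))
    (hKpreg : ∀ K ∈ [Kp11, Kp12, Kp21, Kp22, kp],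
      ContDiffOn ℝ 1 K (Ioo ξ0 a ×ˢ Ioo (0:ℝ) b))
    (hKm11 : ∀ p ∈ Ioo 0 ξ0 ×ˢ Ioo (0:ℝ) b, 0 < Km11 p)
    (hKp11 : ∀ p ∈ Ioo ξ0 a ×ˢ Ioo (0:ℝ) b, 0 < Kp11 p)
    (hKmell : ∀ p ∈ Ioo 0 ξ0 ×ˢ Ioo (0:ℝ) b,
      (Km12 p + Km21 p) ^ 2 < 4 * Km11 p * Km22 p)
    (hKpell : ∀ p ∈ Ioo ξ0 a ×ˢ Ioo (0:ℝ) b,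
      (Kp12 p + Kp21 p) ^ 2 < 4 * Kp11 p * Kp22 p)
    (hkm : ∀ p ∈ Ioo 0 ξ0 ×ˢ Ioo (0:ℝ) b, 0 ≤ km p)
    (hkp : ∀ p ∈ Ioo ξ0 a ×ˢ Ioo (0:ℝ) b, 0 ≤ kp p)
    (hw : RegSol a b ξ0 ξm ξp βm βp Km11 Km12 Km21 Km22 km Kp11 Kp12 Kp21 Kp22 kp
        0 0 0 0 0 w) {z : ℝ × ℝ} (hz : z ∈ Icc 0 a ×ˢ Icc 0 b) : w z ≤ 0 := by
  obtain ⟨w1, w2, w3, w4, w5, w6, w7, w8⟩ := hw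
  obtain ⟨p, hp, hpmax⟩ := (isCompact_Icc.prod isCompact_Icc).exists_isMaxOn ⟨z, hz⟩ w1
  refine (hpmax hz).trans ?_
  by_contra! hMpos
  have hle : ∀ x ∈ Icc 0 a, ∀ y ∈ Icc 0 b, w (x, y) ≤ w p := fun x hx y hy => hpmax ⟨hx, hy⟩
  have hm : ∀ q ∈ Ioo 0 ξ0 ×ˢ Ioo (0:ℝ) b, w q < w p := fun q hq =>
    lt_max_of_rectangle hKmreg hKm11 hKmell hkm
      (w1.mono (prod_mono (Icc_subset_Icc_right hξ0a.le) subset_rfl)) w2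
      (fun p hp => by simp [w4 p hp]) hMpos.le
      (fun r hr => hle r.1 ⟨hr.1.1.le, (hr.1.2.trans hξ0a).le⟩ r.2 ⟨hr.2.1.le, hr.2.2.le⟩)
      (r := (0, 0)) ⟨⟨le_rfl, hξ0.le⟩, le_rfl, hb.le⟩
      (by rw [w6 (0, 0) (Or.inr ⟨rfl, le_rfl, hb.le⟩)]; exact hMpos) hq
  have hpl : ∀ q ∈ Ioo ξ0 a ×ˢ Ioo (0:ℝ) b, w q < w p := fun q hq =>
    lt_max_of_rectangle hKpreg hKp11 hKpell hkp
      (w1.mono (prod_mono (Icc_subset_Icc_left hξ0.le) subset_rfl)) w3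
      (fun p hp => by simp [w5 p hp]) hMpos.le
      (fun r hr => hle r.1 ⟨(hξ0.trans hr.1.1).le, hr.1.2.le⟩ r.2 ⟨hr.2.1.le, hr.2.2.le⟩)
      (r := (a, 0)) ⟨⟨hξ0a.le, le_rfl⟩, le_rfl, hb.le⟩
      (by rw [w7 (a, 0) (Or.inr ⟨rfl, le_rfl, hb.le⟩)]; exact hMpos) hq
  obtain ⟨x, y⟩ := p
  obtain ⟨⟨hx0, hxa⟩, hy0, hyb⟩ := hp
  simp only at hx0 hxa hy0 hyb
  have hy : y ∈ Ioo 0 b := by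
    have hbd : y = 0 ∨ y = b → False := by
      intro h
      have hw0 : w (x, y) = 0 := by
        rcases le_total x ξ0 with hx | hx
        · exact w6 _ (Or.inl (h.imp (fun h => ⟨⟨hx0, hx⟩, h⟩) (fun h => ⟨⟨hx0, hx⟩, h⟩)))
        · exact w7 _ (Or.inl (h.imp (fun h => ⟨⟨hx, hxa⟩, h⟩) (fun h => ⟨⟨hx, hxa⟩, h⟩)))
      exact hMpos.ne' hw0
    exact ⟨lt_of_le_of_ne hy0 fun h => hbd (Or.inl h.symm),
      lt_of_le_of_ne hyb fun h => hbd (Or.inr h)⟩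
  have hx0' : 0 < x := lt_of_le_of_ne hx0 fun h =>
    hMpos.ne' (w6 _ (Or.inr ⟨h.symm, hy0, hyb⟩))
  have hxa' : x < a := lt_of_le_of_ne hxa fun h => hMpos.ne' (w7 _ (Or.inr ⟨h, hy0, hyb⟩))
  rcases lt_trichotomy x ξ0 with hx | hx | hx
  · exact lt_irrefl _ (hm (x, y) ⟨⟨hx0', hx⟩, hy⟩)
  · subst hx
    have hA : ∀ i, βm i * w (ξm i, y) < βm i * w (x, y) := fun i =>
      mul_lt_mul_of_pos_left (hm _ ⟨hξm i, hy⟩) (hβm i)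
    have hB : ∀ j, βp j * w (ξp j, y) < βp j * w (x, y) := fun j =>
      mul_lt_mul_of_pos_left (hpl _ ⟨hξp j, hy⟩) (hβp j)
    have hw8 := w8 y ⟨hy0, hyb⟩
    simp only [Pi.zero_apply, add_zero] at hw8
    have hlt : (∑ i, βm i * w (ξm i, y)) + (∑ j, βp j * w (ξp j, y)) <
        (∑ i, βm i * w (x, y)) + (∑ j, βp j * w (x, y)) := by
      have sA := Finset.sum_le_sum fun i (_ : i ∈ Finset.univ) => (hA i).le
      have sB := Finset.sum_le_sum fun j (_ : j ∈ Finset.univ) => (hB j).le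
      rcases isEmpty_or_nonempty (Fin n) with hn | hn
      · rcases isEmpty_or_nonempty (Fin m) with hm' | hm'
        · simp at hβpos
        · exact add_lt_add_of_le_of_lt sA
            (Finset.sum_lt_sum_of_nonempty Finset.univ_nonempty fun j _ => hB j)
      · exact add_lt_add_of_lt_of_le
          (Finset.sum_lt_sum_of_nonempty Finset.univ_nonempty fun i _ => hA i) sB
    rw [← hw8, ← Finset.sum_mul, ← Finset.sum_mul, ← add_mul] at hlt
    have := mul_le_mul_of_nonneg_right hβ1 hMpos.le
    linarith
  · exact lt_irrefl _ (hpl (x, y) ⟨⟨hx, hxa'⟩, hy⟩)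

end Uniqueness

/-- Theorem 2: uniqueness of the regular solution of the nonlocal
contact problem for an elliptic equation with variable coefficients, under the
condition `0 < Σ βᵢ⁻ + Σ βⱼ⁺ ≤ 1`. -/
theorem stmt_6 (a b ξ0 : ℝ) (ha : 0 < a) (hb : 0 < b)
    (hξ0 : 0 < ξ0) (hξ0a : ξ0 < a)
    (n m : ℕ) (ξm : Fin n → ℝ) (ξp : Fin m → ℝ)
    (hξm : ∀ i, 0 < ξm i ∧ ξm i < ξ0)
    (hξmmono : ∀ i j : Fin n, i < j → ξm j < ξm i)
    (hξp : ∀ j, ξ0 < ξp j ∧ ξp j < a)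
    (hξpmono : ∀ i j : Fin m, i < j → ξp i < ξp j)
    (βm : Fin n → ℝ) (βp : Fin m → ℝ)
    (hβm : ∀ i, 0 < βm i) (hβp : ∀ j, 0 < βp j)
    (hβpos : 0 < (∑ i, βm i) + (∑ j, βp j))
    (hβ1 : (∑ i, βm i) + (∑ j, βp j) ≤ 1)
    (Km11 Km12 Km21 Km22 km Kp11 Kp12 Kp21 Kp22 kp : ℝ × ℝ → ℝ)
    (hKmreg : ∀ K ∈ [Km11, Km12, Km21, Km22, km],
      ContDiffOn ℝ 1 K (Ioo 0 ξ0 ×ˢ Ioo (0:ℝ) b))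
    (hKpreg : ∀ K ∈ [Kp11, Kp12, Kp21, Kp22, kp],
      ContDiffOn ℝ 1 K (Ioo ξ0 a ×ˢ Ioo (0:ℝ) b))
    (hKm11 : ∀ p ∈ Ioo 0 ξ0 ×ˢ Ioo (0:ℝ) b, 0 < Km11 p)
    (hKp11 : ∀ p ∈ Ioo ξ0 a ×ˢ Ioo (0:ℝ) b, 0 < Kp11 p)
    (hKmell : ∀ p ∈ Ioo 0 ξ0 ×ˢ Ioo (0:ℝ) b,
      (Km12 p + Km21 p) ^ 2 < 4 * Km11 p * Km22 p)
    (hKpell : ∀ p ∈ Ioo ξ0 a ×ˢ Ioo (0:ℝ) b,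
      (Kp12 p + Kp21 p) ^ 2 < 4 * Kp11 p * Kp22 p)
    (hkm : ∀ p ∈ Ioo 0 ξ0 ×ˢ Ioo (0:ℝ) b, 0 ≤ km p)
    (hkp : ∀ p ∈ Ioo ξ0 a ×ˢ Ioo (0:ℝ) b, 0 ≤ kp p)
    (fm fp φm φp : ℝ × ℝ → ℝ) (φ0 : ℝ → ℝ) :
    ∀ u v : ℝ × ℝ → ℝ,
      RegSol a b ξ0 ξm ξp βm βp Km11 Km12 Km21 Km22 km Kp11 Kp12 Kp21 Kp22 kp
        fm fp φm φp φ0 u →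
      RegSol a b ξ0 ξm ξp βm βp Km11 Km12 Km21 Km22 km Kp11 Kp12 Kp21 Kp22 kp
        fm fp φm φp φ0 v →
      Set.EqOn u v (Icc 0 a ×ˢ Icc 0 b) := by
  intro u v hu hv z hz
  have h1 := (hu.sub hKmreg hKpreg hv).nonpos hb hξ0 hξ0a hξm hξp hβm hβp hβpos hβ1 hKmreg hKpreg
    hKm11 hKp11 hKmell hKpell hkm hkp hz
  have h2 := (hv.sub hKmreg hKpreg hu).nonpos hb hξ0 hξ0a hξm hξp hβm hβp hβpos hβ1 hKmreg hKpreg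
    hKm11 hKp11 hKmell hKpell hkm hkp hz
  linarith
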